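/- Expansion of the constrained gradient: there exist constants C > 0 and δ > 0 such that for all even functions u, v : ℝ → ℝ that are differentiable with u, u', v, v' square-integrable, satisfy ⟨u,η⟩ = ⟨v,η⟩ = 0 and ‖u‖_{H¹} ≤ δ, the map s ↦ 𝓗(u + s·v) is differentiable at s = 0 and | d/ds|_{s=0} 𝓗(u + s·v) − Q(u,v) | ≤ C·‖u‖_{H¹}²·‖v‖_{L²}, where Q(u,v) = ∫_ℝ ( (1/2)·u'v' + (1/8)·u·v − 3·η²·u·v ) dx. -/

import Mathlib

open MeasureTheory

/-- The ground state `η(x) = (1/2) sech(x/2)`. -/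
noncomputable def eta (x : ℝ) : ℝ := (1/2) * (1 / Real.cosh (x/2))

/-- The energy `H(ψ) = (1/4) ∫ (ψ'² − ψ⁴)`. -/
noncomputable def energy (ψ : ℝ → ℝ) : ℝ := (1/4) * ∫ x : ℝ, ((deriv ψ x)^2 - (ψ x)^4)

/-- Squared `H¹` norm: `‖f‖_{H¹}² = ∫ (f² + f'²)`. -/
noncomputable def H1sq (f : ℝ → ℝ) : ℝ := ∫ x : ℝ, ((f x)^2 + (deriv f x)^2)

/-- The restricted energy on the unit `L²` sphere in the chart around `η`:
`𝓗(u) = H(√(1 − ∫ u²)·η + u)`. -/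
noncomputable def calH (u : ℝ → ℝ) : ℝ :=
  energy (fun x => Real.sqrt (1 - ∫ y : ℝ, (u y)^2) * eta x + u x)

/-- The bilinear form of the linearized operator:
`Q(u,v) = ∫ ((1/2)u'v' + (1/8)uv − 3η²uv)`. -/
noncomputable def Qform (u v : ℝ → ℝ) : ℝ :=
  ∫ x : ℝ, ((1/2) * deriv u x * deriv v x + (1/8) * u x * v x - 3 * (eta x)^2 * u x * v x)

/-! ### The ground state -/

lemma eta_pos (x : ℝ) : 0 < eta x := by
  have := Real.cosh_pos (x / 2)
  unfold eta; positivity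

lemma eta_le_one (x : ℝ) : eta x ≤ 1 := by
  have h := Real.one_le_cosh (x / 2)
  have : 1 / Real.cosh (x / 2) ≤ 1 := by rw [div_le_one (by linarith)]; exact h
  unfold eta; linarith

lemma abs_eta_le_one (x : ℝ) : |eta x| ≤ 1 := by
  rw [abs_of_pos (eta_pos x)]; exact eta_le_one x

/-- The explicit derivative of `eta`. -/
noncomputable def etaDeriv (x : ℝ) : ℝ := -(1/4) * Real.sinh (x/2) / Real.cosh (x/2) ^ 2

lemma hasDerivAt_half (x : ℝ) : HasDerivAt (fun y : ℝ => y / 2) (1 / 2) x :=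
  (hasDerivAt_id x).div_const 2

lemma hasDerivAt_eta (x : ℝ) : HasDerivAt eta (etaDeriv x) x := by
  have hc := (Real.cosh_pos (x / 2)).ne'
  have h := ((hasDerivAt_const x (1 : ℝ)).fun_div (hasDerivAt_half x).cosh hc).const_mul (1 / 2)
  refine h.congr_deriv ?_
  unfold etaDeriv; field_simp; ring

/-- The profile equation `η'' = η/4 - 2η³`. -/
lemma hasDerivAt_etaDeriv (x : ℝ) :
    HasDerivAt etaDeriv ((1/4) * eta x - 2 * eta x ^ 3) x := by
  have hc := (Real.cosh_pos (x / 2)).ne'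
  have h := ((hasDerivAt_half x).sinh.const_mul (-(1/4))).fun_div
    ((hasDerivAt_half x).cosh.fun_pow 2) (pow_ne_zero 2 hc)
  refine h.congr_deriv ?_
  unfold eta
  have := Real.cosh_sq (x / 2)
  field_simp
  rw [show Real.sinh (x/2) ^ 2 = Real.cosh (x/2) ^ 2 - 1 by linarith]
  ring

lemma continuous_eta : Continuous eta :=
  continuous_iff_continuousAt.2 fun x => (hasDerivAt_eta x).continuousAt

lemma continuous_etaDeriv : Continuous etaDeriv :=
  continuous_iff_continuousAt.2 fun x => (hasDerivAt_etaDeriv x).continuousAt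

lemma abs_etaDeriv_le (x : ℝ) : |etaDeriv x| ≤ 1 * |eta x| := by
  have hc := Real.cosh_pos (x / 2)
  have hs : |Real.sinh (x / 2)| ≤ Real.cosh (x / 2) := by
    apply abs_le_of_sq_le_sq _ hc.le
    linarith [Real.cosh_sq (x / 2)]
  rw [abs_of_pos (eta_pos x)]
  unfold etaDeriv eta
  rw [abs_div, abs_mul, abs_of_pos (pow_pos hc 2), show |-(1/4 : ℝ)| = 1/4 by norm_num,
    div_le_iff₀ (pow_pos hc 2)]
  field_simp
  linarith

lemma integrable_eta_sq : Integrable (fun x => eta x ^ 2) := by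
  refine integrable_inv_one_add_sq.mono' (continuous_eta.pow 2).aestronglyMeasurable
    (.of_forall fun x => ?_)
  have hs : (x / 2) ^ 2 ≤ Real.sinh (x / 2) ^ 2 := by
    rw [sq_le_sq, Real.abs_sinh]
    exact Real.self_le_sinh_iff.2 (abs_nonneg _)
  have hc := Real.cosh_sq (x / 2)
  rw [Real.norm_of_nonneg (by positivity)]
  unfold eta
  have hp : 0 < Real.cosh (x / 2) ^ 2 := by positivity
  rw [show ((1:ℝ) / 2 * (1 / Real.cosh (x/2))) ^ 2 = 1 / (4 * Real.cosh (x/2)^2) by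
    field_simp; norm_num, ← one_div]
  apply one_div_le_one_div_of_le (by positivity)
  nlinarith

lemma memLp_eta : MemLp eta 2 :=
  (memLp_two_iff_integrable_sq continuous_eta.aestronglyMeasurable).2 integrable_eta_sq

lemma memLp_etaDeriv : MemLp etaDeriv 2 :=
  memLp_eta.of_le_mul continuous_etaDeriv.aestronglyMeasurable (.of_forall abs_etaDeriv_le)

lemma integral_eta_sq : ∫ x, eta x ^ 2 = 1 := by
  have hd : ∀ x, HasDerivAt (fun x => -(1 + Real.exp x)⁻¹) (eta x ^ 2) x := by
    intro x
    have hp : 1 + Real.exp x ≠ 0 := by positivity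
    have h := (((Real.hasDerivAt_exp x).const_add 1).fun_inv hp).fun_neg
    refine h.congr_deriv ?_
    unfold eta
    have hy := Real.exp_pos (x / 2)
    have hx : Real.exp x = Real.exp (x / 2) ^ 2 := by
      rw [← Real.exp_nat_mul]; congr 1; push_cast; ring
    rw [Real.cosh_eq, Real.exp_neg, hx]
    field_simp
    ring
  have hb : Filter.Tendsto (fun x => -(1 + Real.exp x)⁻¹) Filter.atBot (nhds (-(1 + 0)⁻¹)) :=
    ((Real.tendsto_exp_atBot.const_add 1).inv₀ (by norm_num)).neg
  have ht : Filter.Tendsto (fun x => -(1 + Real.exp x)⁻¹) Filter.atTop (nhds (-0)) :=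
    (Filter.tendsto_atTop_add_const_left _ 1 Real.tendsto_exp_atTop).inv_tendsto_atTop.neg
  rw [integral_of_hasDerivAt_of_tendsto hd integrable_eta_sq hb ht]
  norm_num

/-! ### Square-integrable bounded functions -/

/-- Bounded functions in `L²(ℝ)`. -/
def BddL2 (f : ℝ → ℝ) : Prop := MemLp f 2 ∧ ∃ K, ∀ x, |f x| ≤ K

namespace BddL2

variable {f g : ℝ → ℝ}

lemma mul_memLp (hf : BddL2 f) (hg : MemLp g 2) : MemLp (fun x => f x * g x) 2 := by
  obtain ⟨K, hK⟩ := hf.2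
  refine hg.of_le_mul (c := K) (hf.1.aestronglyMeasurable.mul hg.aestronglyMeasurable)
    (.of_forall fun x => ?_)
  rw [norm_mul]
  exact mul_le_mul_of_nonneg_right (hK x) (norm_nonneg _)

lemma mul (hf : BddL2 f) (hg : BddL2 g) : BddL2 (fun x => f x * g x) := by
  refine ⟨hf.mul_memLp hg.1, ?_⟩
  obtain ⟨K, hK⟩ := hf.2
  obtain ⟨L, hL⟩ := hg.2
  refine ⟨K * L, fun x => ?_⟩
  rw [abs_mul]
  exact mul_le_mul (hK x) (hL x) (abs_nonneg _) ((abs_nonneg _).trans (hK x))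

lemma add (hf : BddL2 f) (hg : BddL2 g) : BddL2 (fun x => f x + g x) := by
  refine ⟨hf.1.add hg.1, ?_⟩
  obtain ⟨K, hK⟩ := hf.2
  obtain ⟨L, hL⟩ := hg.2
  exact ⟨K + L, fun x => (abs_add_le _ _).trans (add_le_add (hK x) (hL x))⟩

lemma const_mul (c : ℝ) (hf : BddL2 f) : BddL2 (fun x => c * f x) := by
  refine ⟨hf.1.const_mul c, ?_⟩
  obtain ⟨K, hK⟩ := hf.2
  refine ⟨|c| * K, fun x => ?_⟩
  rw [abs_mul]
  exact mul_le_mul_of_nonneg_left (hK x) (abs_nonneg c)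

end BddL2

lemma bddL2_eta : BddL2 eta := ⟨memLp_eta, 1, abs_eta_le_one⟩

/-- `f` is integrable with integral `r`. -/
def HasIntegralEq (f : ℝ → ℝ) (r : ℝ) : Prop := Integrable f ∧ ∫ x, f x = r

lemma MeasureTheory.MemLp.hasIntegral_mul {f g : ℝ → ℝ} (hf : MemLp f 2) (hg : MemLp g 2) :
    HasIntegralEq (fun x => f x * g x) (∫ x, f x * g x) := ⟨hf.integrable_mul hg, rfl⟩

namespace HasIntegralEq

variable {f g : ℝ → ℝ} {a b : ℝ}

lemma add (hf : HasIntegralEq f a) (hg : HasIntegralEq g b) :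
    HasIntegralEq (fun x => f x + g x) (a + b) :=
  ⟨hf.1.add hg.1, by rw [integral_add hf.1 hg.1, hf.2, hg.2]⟩

lemma const_mul (c : ℝ) (hf : HasIntegralEq f a) :
    HasIntegralEq (fun x => c * f x) (c * a) :=
  ⟨hf.1.const_mul c, by rw [integral_const_mul, hf.2]⟩

lemma integral_eq (hf : HasIntegralEq f a) (h : ∀ x, g x = f x) : ∫ x, g x = a := by
  rw [← hf.2]; exact integral_congr_ae (.of_forall h)

end HasIntegralEq

/-- The Cauchy–Schwarz inequality with prescribed bounds on the two factors. -/
lemma abs_integral_mul_le {f g : ℝ → ℝ} (hf : MemLp f 2) (hg : MemLp g 2) {a b : ℝ}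
    (ha : 0 ≤ a) (hb : 0 ≤ b) (hfa : ∫ x, f x ^ 2 ≤ a ^ 2) (hgb : ∫ x, g x ^ 2 ≤ b ^ 2) :
    |∫ x, f x * g x| ≤ a * b := by
  have key : ∀ t : ℝ, 0 ≤ (∫ x, f x ^ 2) * (t * t) + (2 * ∫ x, f x * g x) * t
      + ∫ x, g x ^ 2 := by
    intro t
    have h1 : ∫ x, (t * f x + g x) ^ 2 = _ := HasIntegralEq.integral_eq
      ((((hf.hasIntegral_mul hf).const_mul (t * t)).add
        ((hf.hasIntegral_mul hg).const_mul (2 * t))).add (hg.hasIntegral_mul hg))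
      (fun x => by ring)
    have h2 : 0 ≤ ∫ x, (t * f x + g x) ^ 2 := integral_nonneg fun x => sq_nonneg _
    simp only [sq]
    linarith
  have hd := discrim_le_zero key
  unfold discrim at hd
  have hF : 0 ≤ ∫ x, f x ^ 2 := integral_nonneg fun x => sq_nonneg _
  have hG : 0 ≤ ∫ x, g x ^ 2 := integral_nonneg fun x => sq_nonneg _
  apply abs_le_of_sq_le_sq _ (mul_nonneg ha hb)
  have := mul_le_mul hfa hgb hG (sq_nonneg a)
  nlinarith

/-- Sobolev embedding `H¹(ℝ) ⊂ L^∞(ℝ)`. -/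
lemma sq_le_H1sq {u : ℝ → ℝ} (hu : Differentiable ℝ u)
    (h2 : MemLp u 2) (h2' : MemLp (deriv u) 2) (x : ℝ) : u x ^ 2 ≤ H1sq u := by
  have hd : ∀ y, HasDerivAt (fun y => u y ^ 2) (2 * (u y * deriv u y)) y := fun y =>
    ((hu y).hasDerivAt.fun_pow 2).congr_deriv (by push_cast; ring)
  have hi : Integrable (fun y => 2 * (u y * deriv u y)) :=
    (h2.integrable_mul h2').const_mul 2
  have hs : Integrable (fun y => u y ^ 2 + deriv u y ^ 2) := h2.integrable_sq.add h2'.integrable_sq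
  have h0 := tendsto_zero_of_hasDerivAt_of_integrableOn_Iic (a := x) (fun y _ => hd y)
    hi.integrableOn h2.integrable_sq.integrableOn
  have h := integral_Iic_of_hasDerivAt_of_tendsto (hd x).continuousAt.continuousWithinAt
    (fun y _ => hd y) hi.integrableOn h0
  rw [sub_zero] at h
  rw [← h]
  calc ∫ y in Set.Iic x, 2 * (u y * deriv u y)
      ≤ ∫ y in Set.Iic x, (u y ^ 2 + deriv u y ^ 2) :=
        integral_mono hi.integrableOn hs.integrableOn fun y => by
          change 2 * (u y * deriv u y) ≤ u y ^ 2 + deriv u y ^ 2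
          nlinarith [sq_nonneg (u y - deriv u y)]
    _ ≤ H1sq u := setIntegral_le_integral hs (.of_forall fun y => by positivity)

/-- Testing the profile equation against `w`. -/
lemma integral_etaDeriv_mul {w : ℝ → ℝ} {w' : ℝ → ℝ} (hw : ∀ x, HasDerivAt w (w' x) x)
    (h2 : MemLp w 2) (h2' : MemLp w' 2) :
    ∫ x, etaDeriv x * w' x
      = 2 * (∫ x, (eta x * (eta x * eta x)) * w x) - (1/4) * ∫ x, eta x * w x := by
  have h3 : MemLp (fun x => eta x * (eta x * eta x)) 2 :=
    (bddL2_eta.mul (bddL2_eta.mul bddL2_eta)).1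
  have hI := ((memLp_eta.hasIntegral_mul h2).const_mul (1/4)).add
    ((h3.hasIntegral_mul h2).const_mul (-2))
  have hfun : (fun x => ((1/4) * eta x - 2 * eta x ^ 3) * w x)
      = fun x => 1/4 * (eta x * w x) + -2 * (eta x * (eta x * eta x) * w x) := by
    funext x; ring
  have hI' : Integrable (fun x => ((1/4) * eta x - 2 * eta x ^ 3) * w x) := hfun ▸ hI.1
  rw [integral_mul_deriv_eq_deriv_mul_of_integrable (fun x _ => hasDerivAt_etaDeriv x)
    (fun x _ => hw x) (memLp_etaDeriv.integrable_mul h2') hI'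
    (memLp_etaDeriv.integrable_mul h2), hfun, hI.2]
  ring

/-- Differentiation under the integral sign for powers of a finite combination with
parameter-dependent coefficients. -/
lemma hasDerivAt_integral_sum_pow {n k : ℕ} {a : Fin k → ℝ → ℝ} {a' : Fin k → ℝ}
    {f : Fin k → ℝ → ℝ} {s₀ : ℝ} (ha : ∀ i, HasDerivAt (a i) (a' i) s₀)
    (hf : ∀ p : Fin n → Fin k, Integrable fun x => ∏ j, f (p j) x) :
    HasDerivAt (fun s => ∫ x, (∑ i, a i s * f i x) ^ n)
      (∫ x, n * (∑ i, a i s₀ * f i x) ^ (n - 1) * ∑ i, a' i * f i x) s₀ := by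
  have hb : ∀ p : Fin n → Fin k, DifferentiableAt ℝ (fun s => ∏ j, a (p j) s) s₀ := fun p =>
    (HasDerivAt.fun_finsetProd fun j _ => ha (p j)).differentiableAt
  have hexp : ∀ s x, (∑ i, a i s * f i x) ^ n
      = ∑ p : Fin n → Fin k, (∏ j, a (p j) s) * ∏ j, f (p j) x := by
    intro s x
    rw [Fintype.sum_pow]
    simp only [Finset.prod_mul_distrib]
  have hpt : ∀ x, n * (∑ i, a i s₀ * f i x) ^ (n - 1) * ∑ i, a' i * f i x
      = ∑ p : Fin n → Fin k, deriv (fun s => ∏ j, a (p j) s) s₀ * ∏ j, f (p j) x := by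
    intro x
    have h1 := (HasDerivAt.fun_sum (u := Finset.univ) fun i _ =>
      (ha i).mul_const (f i x)).fun_pow n
    have h2 := HasDerivAt.fun_sum (u := Finset.univ) fun p _ =>
      (hb p).hasDerivAt.mul_const (∏ j, f (p j) x)
    simp only [hexp] at h1
    exact h1.unique h2
  simp only [hexp, hpt]
  have hint : ∀ b : (Fin n → Fin k) → ℝ,
      ∫ x, ∑ p : Fin n → Fin k, b p * ∏ j, f (p j) x
        = ∑ p : Fin n → Fin k, b p * ∫ x, ∏ j, f (p j) x := by
    intro b
    rw [integral_finsetSum _ fun p _ => (hf p).const_mul (b p)]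
    simp only [integral_const_mul]
  simp only [hint]
  exact HasDerivAt.fun_sum fun p _ => (hb p).hasDerivAt.mul_const _

/-! ### The expansion -/

/-- First variation of the energy along `c(s) η + u + s v`. -/
lemma hasDerivAt_energy {u v c : ℝ → ℝ} {c' : ℝ} (hc : HasDerivAt c c' 0)
    (hu : Differentiable ℝ u) (hv : Differentiable ℝ v) (bu : BddL2 u) (bv : BddL2 v)
    (hu' : MemLp (deriv u) 2) (hv' : MemLp (deriv v) 2) :
    HasDerivAt (fun s => energy (fun x => c s * eta x + (u x + s * v x)))
      ((1/2) * (∫ x, (c 0 * etaDeriv x + deriv u x) * (c' * etaDeriv x + deriv v x))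
        - ∫ x, (c 0 * eta x + u x) ^ 3 * (c' * eta x + v x)) 0 := by
  have hψ : ∀ s x, HasDerivAt (fun x => c s * eta x + (u x + s * v x))
      (c s * etaDeriv x + (deriv u x + s * deriv v x)) x := fun s x =>
    ((hasDerivAt_eta x).const_mul _).add
      ((hu x).hasDerivAt.add ((hv x).hasDerivAt.const_mul s))
  have hsplit : ∀ s, energy (fun x => c s * eta x + (u x + s * v x))
      = (1/4) * ((∫ x, (c s * etaDeriv x + deriv u x + s * deriv v x) ^ 2)
        - ∫ x, (c s * eta x + u x + s * v x) ^ 4) := by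
    intro s
    have b1 : BddL2 (fun x => c s * eta x + u x + s * v x) :=
      ((bddL2_eta.const_mul _).add bu).add (bv.const_mul s)
    have m1 : MemLp (fun x => c s * etaDeriv x + deriv u x + s * deriv v x) 2 :=
      ((memLp_etaDeriv.const_mul _).add hu').add (hv'.const_mul s)
    have i4 : Integrable (fun x => (c s * eta x + u x + s * v x) ^ 4) := by
      refine ((b1.mul b1).1.integrable_mul (b1.mul b1).1).congr (.of_forall fun x => ?_)
      simp only [Pi.mul_apply]; ring
    rw [energy, ← integral_sub m1.integrable_sq i4]
    simp only [fun x => (hψ s x).deriv, add_assoc]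
  simp only [hsplit]
  let a : Fin 3 → ℝ → ℝ := ![c, fun _ => 1, fun s => s]
  let a' : Fin 3 → ℝ := ![c', 0, 1]
  let f : Fin 3 → ℝ → ℝ := ![eta, u, v]
  let f' : Fin 3 → ℝ → ℝ := ![etaDeriv, deriv u, deriv v]
  have ha : ∀ i, HasDerivAt (a i) (a' i) 0 := by
    intro i
    fin_cases i
    · exact hc
    · exact hasDerivAt_const _ _
    · exact hasDerivAt_id _
  have hf : ∀ i, BddL2 (f i) := by
    intro i
    fin_cases i
    exacts [bddL2_eta, bu, bv]
  have hf' : ∀ i, MemLp (f' i) 2 := by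
    intro i
    fin_cases i
    exacts [memLp_etaDeriv, hu', hv']
  have h2 := hasDerivAt_integral_sum_pow (n := 2) (f := f') ha fun p => by
    simp only [Fin.prod_univ_two]
    exact (hf' _).integrable_mul (hf' _)
  have h4 := hasDerivAt_integral_sum_pow (n := 4) (f := f) ha fun p => by
    simp only [Fin.prod_univ_four, mul_assoc]
    exact (hf _).1.integrable_mul ((hf _).mul ((hf _).mul (hf _))).1
  simp only [Fin.sum_univ_three, a, a', f, f', Matrix.cons_val_zero, Matrix.cons_val_one,
    Matrix.cons_val, one_mul, zero_mul, add_zero] at h2 h4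
  refine ((h2.sub h4).const_mul (1/4)).congr_deriv ?_
  rw [mul_sub, ← integral_const_mul, ← integral_const_mul, ← integral_const_mul]
  congr 1
  · exact integral_congr_ae (.of_forall fun x => by push_cast; ring)
  · exact integral_congr_ae (.of_forall fun x => by push_cast; ring)

lemma remainder_bound {H p q c c' U B E Sv Su T W R P Z : ℝ} (hp : 0 ≤ p) (hq : 0 ≤ q)
    (hU : U = p ^ 2) (hpH : p ^ 2 ≤ H) (hp1 : p ≤ 1) (hc0 : 0 ≤ c) (hc1 : c ≤ 1)
    (hB : |B| ≤ p * q) (hc' : |c'| ≤ 2 * (p * q)) (hE : |E| ≤ 1) (hSv : |Sv| ≤ q)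
    (hSu : |Su| ≤ p) (hT : |T| ≤ p * q) (hW : |W| ≤ p * p) (hR : |R| ≤ H * q)
    (hP : |P| ≤ H * p) (hZ : |Z| ≤ H * p * q) :
    |-(U * B * E) + c * U * Sv + (1 - 3 * c ^ 2) * c' * Su + 3 * U * T + 3 * B * W
      - 3 * c * R - c' * P - Z| ≤ 20 * H * q := by
  subst hU
  have hH : 0 ≤ H := (sq_nonneg p).trans hpH
  have hc : |c| ≤ 1 := abs_le.2 ⟨by linarith, hc1⟩
  have hcc : |1 - 3 * c ^ 2| ≤ 2 := abs_le.2 ⟨by nlinarith, by nlinarith⟩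
  have hp2 : |p ^ 2| ≤ p ^ 2 := (abs_of_nonneg (sq_nonneg p)).le
  have mul_le : ∀ {x y a b : ℝ}, |x| ≤ a → |y| ≤ b → |x * y| ≤ a * b := by
    intro x y a b hx hy
    rw [abs_mul]
    exact mul_le_mul hx hy (abs_nonneg _) ((abs_nonneg _).trans hx)
  have h3 : |(3 : ℝ)| ≤ 3 := by norm_num
  have t1 := mul_le (mul_le hp2 hB) hE
  have t2 := mul_le (mul_le hc hp2) hSv
  have t3 := mul_le (mul_le hcc hc') hSu
  have t4 := mul_le (mul_le h3 hp2) hT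
  have t5 := mul_le (mul_le h3 hB) hW
  have t6 := mul_le (mul_le h3 hc) hR
  have t7 := mul_le hc' hP
  have e1 : p ^ 2 * q ≤ H * q := mul_le_mul_of_nonneg_right hpH hq
  have e2 : p * (p ^ 2 * q) ≤ 1 * (H * q) := mul_le_mul hp1 e1 (by positivity) zero_le_one
  have e3 : p * (H * q) ≤ 1 * (H * q) := mul_le_mul_of_nonneg_right hp1 (by positivity)
  have e4 : p * (p * (H * q)) ≤ 1 * (H * q) :=
    (mul_le_mul_of_nonneg_left e3 hp).trans (by linarith)
  rw [abs_le] at *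
  constructor <;> nlinarith

/-- The difference between the first variation and the bilinear form `Qform`, when `c² = 1 - ∫ u²`
and `c c' = -∫ u v`. -/
lemma firstVariation_sub_Qform {u v : ℝ → ℝ} {c c' U B : ℝ}
    (hu : Differentiable ℝ u) (hv : Differentiable ℝ v) (bu : BddL2 u) (bv : BddL2 v)
    (hu' : MemLp (deriv u) 2) (hv' : MemLp (deriv v) 2)
    (ou : ∫ x, eta x * u x = 0) (ov : ∫ x, eta x * v x = 0)
    (hc : c ^ 2 = 1 - U) (hcc' : c * c' = -B) (hB : ∫ x, u x * v x = B) :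
    (1/2) * (∫ x, (c * etaDeriv x + deriv u x) * (c' * etaDeriv x + deriv v x))
        - (∫ x, (c * eta x + u x) ^ 3 * (c' * eta x + v x)) - Qform u v
      = -(U * B * ∫ x, (eta x * (eta x * eta x)) * eta x)
        + c * U * (∫ x, (eta x * (eta x * eta x)) * v x)
        + (1 - 3 * c ^ 2) * c' * (∫ x, (eta x * (eta x * eta x)) * u x)
        + 3 * U * (∫ x, (eta x * (eta x * u x)) * v x)
        + 3 * B * (∫ x, (eta x * (eta x * u x)) * u x)
        - 3 * c * (∫ x, (eta x * (u x * u x)) * v x)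
        - c' * (∫ x, (u x * (u x * u x)) * eta x)
        - ∫ x, (u x * (u x * u x)) * v x := by
  have be := bddL2_eta
  have eee := (be.mul (be.mul be)).1
  have eeu := (be.mul (be.mul bu)).1
  have euu := (be.mul (bu.mul bu)).1
  have uuu := (bu.mul (bu.mul bu)).1
  have me := memLp_etaDeriv
  have hkin : ∫ x, (c * etaDeriv x + deriv u x) * (c' * etaDeriv x + deriv v x) = _ :=
    HasIntegralEq.integral_eq
      (((((me.hasIntegral_mul me).const_mul (c * c')).add
        ((me.hasIntegral_mul hv').const_mul c)).add
        ((me.hasIntegral_mul hu').const_mul c')).add (hu'.hasIntegral_mul hv'))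
      (fun x => by ring)
  have hpot : ∫ x, (c * eta x + u x) ^ 3 * (c' * eta x + v x) = _ :=
    HasIntegralEq.integral_eq
      (((((((((eee.hasIntegral_mul be.1).const_mul (c ^ 3 * c')).add
        ((eee.hasIntegral_mul bv.1).const_mul (c ^ 3))).add
        ((eee.hasIntegral_mul bu.1).const_mul (3 * c ^ 2 * c'))).add
        ((eeu.hasIntegral_mul bv.1).const_mul (3 * c ^ 2))).add
        ((eeu.hasIntegral_mul bu.1).const_mul (3 * (c * c')))).add
        ((euu.hasIntegral_mul bv.1).const_mul (3 * c))).add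
        ((uuu.hasIntegral_mul be.1).const_mul c')).add
        (uuu.hasIntegral_mul bv.1))
      (fun x => by ring)
  have hQ : Qform u v = _ :=
    HasIntegralEq.integral_eq
      ((((hu'.hasIntegral_mul hv').const_mul (1/2)).add
        ((bu.1.hasIntegral_mul bv.1).const_mul (1/8))).add
        ((eeu.hasIntegral_mul bv.1).const_mul (-3)))
      (fun x => by ring)
  have h1 : ∫ x, eta x * eta x = 1 := by
    simpa only [sq] using integral_eta_sq
  rw [hkin, hpot, hQ, hB, integral_etaDeriv_mul hasDerivAt_eta be.1 me,
    integral_etaDeriv_mul (fun x => (hu x).hasDerivAt) bu.1 hu',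
    integral_etaDeriv_mul (fun x => (hv x).hasDerivAt) bv.1 hv', ou, ov, h1]
  have h3 : c ^ 3 = c * (1 - U) := by rw [pow_succ, hc]; ring
  have h4 : c ^ 3 * c' = -((1 - U) * B) := by rw [h3]; linear_combination (1 - U) * hcc'
  rw [h4, h3, hcc', hc]
  ring

lemma hasDerivAt_sqrt_mass {u v : ℝ → ℝ} (hu : MemLp u 2) (hv : MemLp v 2)
    (hU : ∫ x, u x ^ 2 < 1) :
    HasDerivAt (fun s => Real.sqrt (1 - ∫ x, (u x + s * v x) ^ 2))
      (-(∫ x, u x * v x) / Real.sqrt (1 - ∫ x, u x ^ 2)) 0 := by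
  have hm : ∀ s : ℝ, ∫ x, (u x + s * v x) ^ 2 = _ := fun s => HasIntegralEq.integral_eq
    (((hu.hasIntegral_mul hu).add ((hu.hasIntegral_mul hv).const_mul (2 * s))).add
      ((hv.hasIntegral_mul hv).const_mul (s ^ 2))) (fun x => by ring)
  have hfun : (fun s : ℝ => Real.sqrt (1 - ∫ x, (u x + s * v x) ^ 2)) = fun s =>
      Real.sqrt (1 - ((∫ x, u x * u x) + 2 * s * (∫ x, u x * v x)
        + s * s * ∫ x, v x * v x)) := by
    funext s
    rw [hm s, sq]
  rw [hfun]
  simp only [sq] at hU ⊢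
  have hid := hasDerivAt_id' (0 : ℝ)
  have h := ((((hid.const_mul 2).mul_const (∫ x, u x * v x)).const_add (∫ x, u x * u x)).add
    ((hid.mul hid).mul_const (∫ x, v x * v x))).const_sub 1
  refine (h.sqrt ?_).congr_deriv ?_
  · simp only [Pi.add_apply, Pi.mul_apply]
    nlinarith
  · simp only [Pi.add_apply, Pi.mul_apply]
    have hpos : 0 < Real.sqrt (1 - ∫ x, u x * u x) := Real.sqrt_pos.2 (by linarith)
    simp only [mul_zero, zero_mul, add_zero]
    field_simp

lemma integral_sq_le {f g : ℝ → ℝ} {K : ℝ} (hg : MemLp g 2)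
    (h : ∀ x, f x ^ 2 ≤ K * g x ^ 2) : ∫ x, f x ^ 2 ≤ K * ∫ x, g x ^ 2 := by
  rw [← integral_const_mul]
  exact integral_mono_of_nonneg (.of_forall fun x => sq_nonneg _)
    (hg.integrable_sq.const_mul K) (.of_forall h)

/-- expansion of the constrained gradient: there are `C > 0`, `δ > 0` such that
for all even `H¹` functions `u, v` orthogonal to `η` with `‖u‖_{H¹} ≤ δ`, the map
`s ↦ 𝓗(u + s·v)` is differentiable at `0` and
`|d/ds|_{s=0} 𝓗(u + sv) − Q(u,v)| ≤ C‖u‖_{H¹}²‖v‖_{L²}`. -/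
theorem constrained_gradient_expansion :
    ∃ C δ : ℝ, 0 < C ∧ 0 < δ ∧
      ∀ u v : ℝ → ℝ,
        (∀ x, u (-x) = u x) → (∀ x, v (-x) = v x) →
        Differentiable ℝ u → Differentiable ℝ v →
        Integrable (fun x => (u x)^2) → Integrable (fun x => (deriv u x)^2) →
        Integrable (fun x => (v x)^2) → Integrable (fun x => (deriv v x)^2) →
        (∫ x : ℝ, u x * eta x) = 0 → (∫ x : ℝ, v x * eta x) = 0 →
        Real.sqrt (H1sq u) ≤ δ →
        DifferentiableAt ℝ (fun s : ℝ => calH (fun x => u x + s * v x)) 0 ∧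
        |deriv (fun s : ℝ => calH (fun x => u x + s * v x)) 0 - Qform u v| ≤
          C * H1sq u * Real.sqrt (∫ x : ℝ, (v x)^2) := by
  refine ⟨20, 1/2, by norm_num, by norm_num, ?_⟩
  intro u v _ _ hu hv iu iu' iv iv' ou ov hδ
  have mu : MemLp u 2 := (memLp_two_iff_integrable_sq hu.continuous.aestronglyMeasurable).2 iu
  have mv : MemLp v 2 := (memLp_two_iff_integrable_sq hv.continuous.aestronglyMeasurable).2 iv
  have mu' : MemLp (deriv u) 2 :=
    (memLp_two_iff_integrable_sq (measurable_deriv u).aestronglyMeasurable).2 iu'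
  have mv' : MemLp (deriv v) 2 :=
    (memLp_two_iff_integrable_sq (measurable_deriv v).aestronglyMeasurable).2 iv'
  have bu : BddL2 u := ⟨mu, _, fun x => Real.abs_le_sqrt (sq_le_H1sq hu mu mu' x)⟩
  have bv : BddL2 v := ⟨mv, _, fun x => Real.abs_le_sqrt (sq_le_H1sq hv mv mv' x)⟩
  have hsup := sq_le_H1sq hu mu mu'
  have hUH : ∫ x, u x ^ 2 ≤ H1sq u :=
    integral_mono iu (iu.add iu') fun x => by simp; positivity
  have hU0 : 0 ≤ ∫ x, u x ^ 2 := integral_nonneg fun x => sq_nonneg _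
  have hV0 : 0 ≤ ∫ x, v x ^ 2 := integral_nonneg fun x => sq_nonneg _
  have hH : H1sq u ≤ 1/4 := by
    have := (Real.sqrt_le_left (by norm_num)).1 hδ
    linarith
  have hd := hasDerivAt_energy (hasDerivAt_sqrt_mass mu mv (by linarith)) hu hv bu bv mu' mv'
  set p := Real.sqrt (∫ x, u x ^ 2) with hp
  set q := Real.sqrt (∫ x, v x ^ 2) with hq
  have hp2 : p ^ 2 = ∫ x, u x ^ 2 := Real.sq_sqrt hU0
  have hq2 : q ^ 2 = ∫ x, v x ^ 2 := Real.sq_sqrt hV0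
  have hp0 : 0 ≤ p := Real.sqrt_nonneg _
  have hq0 : 0 ≤ q := Real.sqrt_nonneg _
  have hH0 : 0 ≤ H1sq u := hU0.trans hUH
  simp only [zero_mul, add_zero] at hd
  set c := Real.sqrt (1 - ∫ x, u x ^ 2) with hc
  have hc2 : c ^ 2 = 1 - ∫ x, u x ^ 2 := Real.sq_sqrt (by linarith)
  have hc1 : c ≤ 1 := Real.sqrt_le_one.2 (by linarith)
  have hch : 1/2 ≤ c := Real.le_sqrt_of_sq_le (by linarith)
  refine ⟨hd.differentiableAt, ?_⟩
  rw [show deriv (fun s : ℝ => calH (fun x => u x + s * v x)) 0 = _ from hd.deriv]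
  simp only [mul_comm _ (eta _)] at ou ov
  rw [firstVariation_sub_Qform hu hv bu bv mu' mv' ou ov hc2
    (mul_div_cancel₀ _ (by linarith : c ≠ 0)) rfl]
  have eta_sq_le : ∀ x, eta x ^ 2 ≤ 1 := fun x => (sq_le_one_iff_abs_le_one _).2 (abs_eta_le_one x)
  have hup : ∫ x, u x ^ 2 ≤ p ^ 2 := hp2.ge
  have hvq : ∫ x, v x ^ 2 ≤ q ^ 2 := hq2.ge
  have hη : ∫ x, eta x ^ 2 ≤ 1 ^ 2 := by rw [integral_eta_sq]; norm_num
  have be := bddL2_eta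
  have mee {w : ℝ → ℝ} (bw : BddL2 w) : ∫ x, (eta x * (eta x * w x)) ^ 2 ≤ ∫ x, w x ^ 2 := by
    refine (integral_sq_le (K := 1) bw.1 fun x => ?_).trans_eq (one_mul _)
    have := mul_le_mul (eta_sq_le x) (eta_sq_le x) (sq_nonneg _) zero_le_one
    nlinarith [mul_le_mul_of_nonneg_right this (sq_nonneg (w x))]
  have meuu : ∫ x, (eta x * (u x * u x)) ^ 2 ≤ H1sq u ^ 2 := by
    refine (integral_sq_le (K := H1sq u) mu fun x => ?_).trans (by nlinarith)
    have := mul_le_mul (eta_sq_le x) (hsup x) (sq_nonneg _) zero_le_one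
    nlinarith [mul_le_mul_of_nonneg_right this (sq_nonneg (u x))]
  have muuu : ∫ x, (u x * (u x * u x)) ^ 2 ≤ (H1sq u * p) ^ 2 := by
    refine (integral_sq_le (K := H1sq u ^ 2) mu fun x => ?_).trans_eq (by rw [mul_pow, hp2])
    have := mul_le_mul (hsup x) (hsup x) (sq_nonneg _) hH0
    nlinarith [mul_le_mul_of_nonneg_right this (sq_nonneg (u x))]
  have eee := (be.mul (be.mul be)).1
  have eeu := (be.mul (be.mul bu)).1
  have euu := (be.mul (bu.mul bu)).1
  have uuu := (bu.mul (bu.mul bu)).1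
  have hB := abs_integral_mul_le mu mv hp0 hq0 hup hvq
  have hc' : |(-∫ x, u x * v x) / c| ≤ 2 * (p * q) := by
    rw [abs_div, abs_neg, abs_of_pos (by linarith : 0 < c), div_le_iff₀ (by linarith)]
    nlinarith [mul_nonneg hp0 hq0]
  refine remainder_bound hp0 hq0 hp2.symm (hp2.trans_le hUH)
    (abs_le_of_sq_le_sq (by linarith) zero_le_one |> (le_abs_self p).trans)
    (by linarith) hc1 hB hc' ?_ ?_ ?_ ?_ ?_ ?_ ?_ ?_
  · simpa using abs_integral_mul_le eee be.1 zero_le_one zero_le_one ((mee be).trans hη) hη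
  · simpa using abs_integral_mul_le eee mv zero_le_one hq0 ((mee be).trans hη) hvq
  · simpa using abs_integral_mul_le eee mu zero_le_one hp0 ((mee be).trans hη) hup
  · exact abs_integral_mul_le eeu mv hp0 hq0 ((mee bu).trans hup) hvq
  · exact abs_integral_mul_le eeu mu hp0 hp0 ((mee bu).trans hup) hup
  · exact abs_integral_mul_le euu mv hH0 hq0 meuu hvq
  · simpa using abs_integral_mul_le uuu be.1 (mul_nonneg hH0 hp0) zero_le_one muuu hη
  · exact abs_integral_mul_le uuu mv (mul_nonneg hH0 hp0) hq0 muuu hvq
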